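/- Let n be an odd integer and let k be an integer with 2 ≤ k ≤ ⌊n/2⌋ such that n ≡ k − 1 (mod k) (i.e., writing n = a·k + r with 0 ≤ r < k, one has r = k − 1). Then mbt(C(n,k)) = Δ(C(n,k)) + 1 = 5. -/

import Mathlib

open SimpleGraph

/-- The circulant graph `C(ℤ_n, S)`: vertices are `ZMod n`, and distinct `i, j` are
adjacent iff `i - j ≡ s` or `i - j ≡ -s (mod n)` for some `s ∈ S`. -/
def circulant (n : ℕ) (S : Set ℤ) : SimpleGraph (ZMod n) :=
  SimpleGraph.fromRel fun i j => ∃ s ∈ S, i - j = (s : ZMod n)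

/-- `C(n,k) = C(ℤ_n, {1, k})`. -/
def circ (n k : ℕ) : SimpleGraph (ZMod n) := circulant n {1, (k : ℤ)}

/-- The maximum degree `Δ(G)` of a graph. -/
noncomputable def maxDeg {V : Type*} (G : SimpleGraph V) : ℕ :=
  sSup (Set.range fun v => (G.neighborSet v).ncard)

/-- `x` lies strictly between positions `a` and `b` on the circular layout
(cut open along the linear order of `Fin N`). -/
def ChordBetween {N : ℕ} (x a b : Fin N) : Prop := min a b < x ∧ x < max a b

/-- The chords joining the positions `a,b` and `c,d` on a circle cross iff exactly one of
`c, d` lies strictly between `a` and `b`. -/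
def ChordCross {N : ℕ} (a b c d : Fin N) : Prop :=
  Xor' (ChordBetween c a b) (ChordBetween d a b)

/-- `G` admits a matching book embedding in `m` pages: there is a circular layout
(a bijection of the vertices with `Fin (Nat.card V)`) and a proper edge coloring with
`m` colors such that crossing edges get distinct colors. -/
def HasMBE {V : Type*} (G : SimpleGraph V) (m : ℕ) : Prop :=
  ∃ (σ : V ≃ Fin (Nat.card V)) (col : V → V → Fin m),
    (∀ u v, G.Adj u v → col u v = col v u) ∧
    (∀ u v w, G.Adj u v → G.Adj u w → v ≠ w → col u v ≠ col u w) ∧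
    (∀ a b c d, G.Adj a b → G.Adj c d →
      ChordCross (σ a) (σ b) (σ c) (σ d) → col a b ≠ col c d)

/-- The matching book thickness `mbt(G)`. -/
noncomputable def mbt {V : Type*} (G : SimpleGraph V) : ℕ :=
  sInf {m | HasMBE G m}

/-- The remainder algorithm from the paper: `k₀ = k`, `r₀ = r`,
`k_{i+1} = k_i - r_i`, `r_{i+1} = k_i mod k_{i+1}`. -/
def euclidSeq (k r : ℕ) : ℕ → ℕ × ℕ
  | 0 => (k, r)
  | i + 1 =>
      ((euclidSeq k r i).1 - (euclidSeq k r i).2,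
       (euclidSeq k r i).1 % ((euclidSeq k r i).1 - (euclidSeq k r i).2))

/-! ### Combinatorial core: the twisted grid -/

/-- Boustrophedon order on grid points. -/
def bLt (r c r' c' : ℕ) : Prop :=
  r < r' ∨ (r = r' ∧ ((r % 2 = 0 ∧ c < c') ∨ (r % 2 = 1 ∧ c' < c)))

/-- Colors of the edges of the Hamiltonian path (colors `2,3,4`). -/
def pathCol (q k r c : ℕ) : ℕ :=
  if k % 2 = 1 then
    if r = q - 1 ∧ c + 3 = k then 4 else if (r + c) % 2 = 0 then 2 else 3
  else
    if (r = 0 ∧ c = 1) ∨ (r % 2 = 0 ∧ r + 2 < q ∧ c + 1 = k) then 4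
    else if r = 0 ∧ c = 0 then 2 else if c % 2 = 0 then 3 else 2

/-- Oriented coloured edges of the grid; `tall` edges are those not inside a row. -/
def tallEdge (q k r c r' c' m : ℕ) : Prop :=
  (r' = r + 1 ∧ c + 1 = k ∧ c' = 0 ∧ m = pathCol q k r c) ∨
  (r' = r + 1 ∧ c' = c ∧ m = r % 2) ∨
  (r = 0 ∧ r' + 1 = q ∧ c = c' + 1 ∧ m = 1) ∨
  (r = 0 ∧ c = 0 ∧ r' + 2 = q ∧ c' + 1 = k ∧ m = 4) ∨
  (r = 0 ∧ c = 0 ∧ r' + 1 = q ∧ c' + 2 = k ∧ m = 3)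

def gridEdge (q k r c r' c' m : ℕ) : Prop :=
  (r = r' ∧ c' = c + 1 ∧ m = pathCol q k r c) ∨ tallEdge q k r c r' c' m

/-- valid grid points -/
def okPt (q k r c : ℕ) : Prop := r < q ∧ c < k ∧ ¬ (r + 1 = q ∧ c + 1 = k)

lemma pathCol_ge (q k r c : ℕ) : 2 ≤ pathCol q k r c ∧ pathCol q k r c ≤ 4 := by
  unfold pathCol; split_ifs <;> omega

lemma tall_lt {q k r c r' c' m : ℕ} (hk : 2 ≤ k) (h : tallEdge q k r c r' c' m)
    (hq : q % 2 = 0) (hq2 : 2 ≤ q) : bLt r c r' c' := by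
  unfold tallEdge at h; unfold bLt
  generalize pathCol q k r c = p at h
  omega

lemma tall_noncross {q k : ℕ} (hq : q % 2 = 0) (hq2 : 2 ≤ q) (hk : 2 ≤ k) (hqk : 5 ≤ q + k)
    {r₁ c₁ r₂ c₂ r₃ c₃ r₄ c₄ m : ℕ}
    (h₁ : okPt q k r₁ c₁) (h₂ : okPt q k r₂ c₂) (h₃ : okPt q k r₃ c₃) (h₄ : okPt q k r₄ c₄)
    (e : tallEdge q k r₁ c₁ r₂ c₂ m) (e' : tallEdge q k r₃ c₃ r₄ c₄ m)
    (l₁ : bLt r₁ c₁ r₃ c₃) (l₂ : bLt r₃ c₃ r₂ c₂) (l₃ : bLt r₂ c₂ r₄ c₄) : False := by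
  have g₁ := pathCol_ge q k r₁ c₁
  have g₂ := pathCol_ge q k r₃ c₃
  unfold okPt at *
  unfold bLt at *
  rcases e with e | e | e | e | e <;> rcases e' with e' | e' | e' | e' | e' <;>
    first
    | omega
    | (unfold pathCol at *; split_ifs at * <;> omega)

set_option maxHeartbeats 4000000 in
lemma grid_disjoint {q k : ℕ} (hq : q % 2 = 0) (hq2 : 2 ≤ q) (hk : 2 ≤ k) (hqk : 5 ≤ q + k)
    {r₁ c₁ r₂ c₂ r₃ c₃ r₄ c₄ m : ℕ}
    (h₁ : okPt q k r₁ c₁) (h₂ : okPt q k r₂ c₂) (h₃ : okPt q k r₃ c₃) (h₄ : okPt q k r₄ c₄)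
    (e : gridEdge q k r₁ c₁ r₂ c₂ m) (e' : gridEdge q k r₃ c₃ r₄ c₄ m) :
    (r₁ = r₃ ∧ c₁ = c₃ ∧ r₂ = r₄ ∧ c₂ = c₄) ∨
    (¬ (r₁ = r₃ ∧ c₁ = c₃) ∧ ¬ (r₁ = r₄ ∧ c₁ = c₄) ∧ ¬ (r₂ = r₃ ∧ c₂ = c₃) ∧
      ¬ (r₂ = r₄ ∧ c₂ = c₄)) := by
  have g₁ := pathCol_ge q k r₁ c₁
  have g₂ := pathCol_ge q k r₃ c₃
  unfold okPt at *
  rcases e with e | e | e | e | e | e <;> rcases e' with e' | e' | e' | e' | e' | e' <;>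
    first
    | omega
    | (unfold pathCol at *; split_ifs at * <;> omega)

lemma row_no_between {r c r' c' : ℕ} (l₁ : bLt r c r' c' ∧ bLt r' c' r (c + 1)) : False := by
  unfold bLt at *; omega

lemma row_no_between' {r c r' c' : ℕ} (l₁ : bLt r (c + 1) r' c' ∧ bLt r' c' r c) : False := by
  unfold bLt at *; omega

/-! ### From coloured oriented edges to matching book embeddings -/

set_option maxHeartbeats 2000000 in
lemma hasMBE_of_edges {V K : Type*} [Fintype V] [LinearOrder K] (key : V → K)
    (inj : Function.Injective key) (G : SimpleGraph V) {m : ℕ} [NeZero m]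
    (E : V → V → Fin m → Prop)
    (hE : ∀ u v, G.Adj u v → ∃ i, E u v i ∨ E v u i)
    (hd : ∀ a b c d i, E a b i → E c d i →
      (a = c ∧ b = d) ∨ (a ≠ c ∧ a ≠ d ∧ b ≠ c ∧ b ≠ d))
    (hx : ∀ a b c d i, E a b i → E c d i → ∀ lo hi lo' hi',
      ((lo = a ∧ hi = b) ∨ (lo = b ∧ hi = a)) → ((lo' = c ∧ hi' = d) ∨ (lo' = d ∧ hi' = c)) →
      key lo < key lo' → key lo' < key hi → key hi < key hi' → False) :
    HasMBE G m := by
  classical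
  letI : LinearOrder V := LinearOrder.lift' key inj
  let σ : V ≃o Fin (Nat.card V) :=
    (Fintype.orderIsoFinOfCardEq V (Nat.card_eq_fintype_card).symm).symm
  have hσ : ∀ u v, σ u < σ v → key u < key v := by
    intro u v h
    have h' : u < v := σ.lt_iff_lt.mp h
    exact h'
  let col : V → V → Fin m := fun u v => Classical.epsilon (fun i => E u v i ∨ E v u i)
  have hcol : ∀ u v, G.Adj u v → E u v (col u v) ∨ E v u (col u v) := fun u v h =>
    Classical.epsilon_spec (hE u v h)
  refine ⟨σ.toEquiv, col, ?_, ?_, ?_⟩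
  · intro u v _
    simp only [col]
    congr 1
    funext i
    exact propext or_comm
  · intro u v w huv huw hvw heq
    have h1 := hcol u v huv
    have h2 := hcol u w huw
    rw [← heq] at h2
    have := huv.ne
    have := huw.ne
    rcases h1 with h1 | h1 <;> rcases h2 with h2 | h2 <;>
      rcases hd _ _ _ _ _ h1 h2 with h | h <;> grind
  · intro a b c d hab hcd hcr heq
    have h1 := hcol a b hab
    have h2 := hcol c d hcd
    rw [← heq] at h2
    have key1 : ∀ a b c d i, E a b i → E c d i → ¬ ChordCross (σ a) (σ b) (σ c) (σ d) := by
      intro a b c d i e e' hc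
      have hne := hd _ _ _ _ _ e e'
      have X := hx _ _ _ _ _ e e'
      have Y := hx _ _ _ _ _ e' e
      have S : ∀ u v, u ≠ v → (σ u : ℕ) ≠ σ v := by
        intro u v h h'
        exact h (σ.injective (Fin.ext h'))
      have T : ∀ u v, (σ u : ℕ) < σ v → key u < key v := fun u v h => hσ u v h
      rcases hne with ⟨rfl, rfl⟩ | ⟨n1, n2, n3, n4⟩
      · unfold ChordCross ChordBetween at hc
        simp only [min_lt_iff, lt_max_iff, Fin.lt_def, Xor', Xor] at hc
        omega
      · have s1 := S _ _ n1
        have s2 := S _ _ n2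
        have s3 := S _ _ n3
        have s4 := S _ _ n4
        unfold ChordCross ChordBetween at hc
        simp only [min_lt_iff, lt_max_iff, Fin.lt_def, Xor', Xor] at hc
        have Z : ∀ lo hi lo' hi' : V,
            ((lo = a ∧ hi = b) ∨ (lo = b ∧ hi = a)) →
            ((lo' = c ∧ hi' = d) ∨ (lo' = d ∧ hi' = c)) →
            ¬ ((σ lo : ℕ) < σ lo' ∧ (σ lo' : ℕ) < σ hi ∧ (σ hi : ℕ) < σ hi') ∧
            ¬ ((σ lo' : ℕ) < σ lo ∧ (σ lo : ℕ) < σ hi' ∧ (σ hi' : ℕ) < σ hi) := by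
          intro lo hi lo' hi' p p'
          exact ⟨fun h => X lo hi lo' hi' p p' (T _ _ h.1) (T _ _ h.2.1) (T _ _ h.2.2),
            fun h => Y lo' hi' lo hi p' p (T _ _ h.1) (T _ _ h.2.1) (T _ _ h.2.2)⟩
        have z1 := Z a b c d (Or.inl ⟨rfl, rfl⟩) (Or.inl ⟨rfl, rfl⟩)
        have z2 := Z a b d c (Or.inl ⟨rfl, rfl⟩) (Or.inr ⟨rfl, rfl⟩)
        have z3 := Z b a c d (Or.inr ⟨rfl, rfl⟩) (Or.inl ⟨rfl, rfl⟩)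
        have z4 := Z b a d c (Or.inr ⟨rfl, rfl⟩) (Or.inr ⟨rfl, rfl⟩)
        clear X Y S T Z
        generalize (σ a : ℕ) = A at *
        generalize (σ b : ℕ) = B at *
        generalize (σ c : ℕ) = C at *
        generalize (σ d : ℕ) = D at *
        rcases lt_or_ge A B with q1 | q1 <;> rcases lt_or_ge C D with q2 | q2 <;>
          rcases lt_or_gt_of_ne s1 with q3 | q3 <;> rcases lt_or_gt_of_ne s2 with q4 | q4 <;>
          rcases lt_or_gt_of_ne s3 with q5 | q5 <;> rcases lt_or_gt_of_ne s4 with q6 | q6 <;>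
          omega
    have sw1 : ChordCross (σ b) (σ a) (σ c) (σ d) := by
      unfold ChordCross ChordBetween at *
      rw [min_comm, max_comm]; exact hcr
    have sw2 : ∀ x y, ChordCross x y (σ c) (σ d) → ChordCross x y (σ d) (σ c) := by
      intro x y h
      unfold ChordCross at *
      exact Or.symm h
    rcases h1 with h1 | h1 <;> rcases h2 with h2 | h2
    · exact key1 _ _ _ _ _ h1 h2 hcr
    · exact key1 _ _ _ _ _ h1 h2 (sw2 _ _ hcr)
    · exact key1 _ _ _ _ _ h1 h2 sw1
    · exact key1 _ _ _ _ _ h1 h2 (sw2 _ _ sw1)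

lemma circ_adj {n k : ℕ} {u v : ZMod n} (h : (circ n k).Adj u v) :
    v = u + 1 ∨ v = u + (k : ZMod n) ∨ u = v + 1 ∨ u = v + (k : ZMod n) := by
  unfold circ circulant at h
  simp only [SimpleGraph.fromRel_adj, Set.mem_insert_iff, Set.mem_singleton_iff,
    exists_eq_or_imp, exists_eq_left] at h
  push_cast at h
  rcases h.2 with (h | h) | (h | h)
  · right; right; left; rw [← h]; ring
  · right; right; right; rw [← h]; ring
  · left; rw [← h]; ring
  · right; left; rw [← h]; ring

lemma circ_adj_iff {n k : ℕ} {u v : ZMod n} : (circ n k).Adj u v ↔ u ≠ v ∧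
    (v = u + 1 ∨ v = u + (k : ZMod n) ∨ u = v + 1 ∨ u = v + (k : ZMod n)) := by
  refine ⟨fun h => ⟨h.ne, circ_adj h⟩, fun ⟨hne, h⟩ => ?_⟩
  unfold circ circulant
  simp only [SimpleGraph.fromRel_adj, Set.mem_insert_iff, Set.mem_singleton_iff,
    exists_eq_or_imp, exists_eq_left]
  push_cast
  refine ⟨hne, ?_⟩
  rcases h with h | h | h | h <;> rw [h] <;> simp

/-- Order key of a grid point. -/
def bKey (r c : ℕ) : ℕ ×ₗ ℤ := toLex (r, if r % 2 = 0 then (c : ℤ) else -(c : ℤ))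

lemma bKey_lt {r c r' c' : ℕ} : bKey r c < bKey r' c' ↔ bLt r c r' c' := by
  unfold bKey bLt
  rw [Prod.Lex.toLex_lt_toLex]
  simp only
  split_ifs <;> omega

lemma divmod_eq {k r c x : ℕ} (hc : c < k) (hx : x = r * k + c) : x / k = r ∧ x % k = c := by
  subst hx
  constructor
  · rw [add_comm, Nat.add_mul_div_right _ _ (by omega), Nat.div_eq_of_lt hc, zero_add]
  · rw [add_comm, Nat.add_mul_mod_self_right, Nat.mod_eq_of_lt hc]

lemma okPt_of_lt {n q k x : ℕ} (hk : 2 ≤ k) (hn : n + 1 = q * k) (hx : x < n) :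
    okPt q k (x / k) (x % k) := by
  have h1 := Nat.div_add_mod x k
  have h2 := Nat.mod_lt x (show 0 < k by omega)
  refine ⟨(Nat.div_lt_iff_lt_mul (by omega)).mpr (by omega), h2, ?_⟩
  rintro ⟨h3, h4⟩
  rw [← h3, add_mul, mul_comm] at hn
  omega

lemma step_one {n q k x : ℕ} (hk : 2 ≤ k) (hq : 2 ≤ q) (hn : n + 1 = q * k) (hx : x < n) :
    ∃ i, i < 5 ∧
      (gridEdge q k (x / k) (x % k) ((x + 1) % n / k) ((x + 1) % n % k) i ∨
       gridEdge q k ((x + 1) % n / k) ((x + 1) % n % k) (x / k) (x % k) i) := by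
  have h1 := Nat.div_add_mod x k
  have h2 := Nat.mod_lt x (show 0 < k by omega)
  set r := x / k
  set c := x % k
  have hp := pathCol_ge q k r c
  by_cases hxn : x + 1 = n
  · have : (x + 1) % n = 0 := by rw [hxn, Nat.mod_self]
    rw [this, Nat.zero_div, Nat.zero_mod]
    obtain ⟨q', rfl⟩ : ∃ q', q = q' + 1 := ⟨q - 1, by omega⟩
    have := divmod_eq (k := k) (r := q') (c := k - 2) (x := x) (by omega)
      (by rw [add_mul] at hn; omega)
    refine ⟨3, by omega, Or.inr (Or.inr ?_)⟩
    unfold tallEdge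
    omega
  · rw [Nat.mod_eq_of_lt (show x + 1 < n by omega)]
    by_cases hc : c + 1 = k
    · have := divmod_eq (k := k) (r := r + 1) (c := 0) (x := x + 1) (by omega)
        (by rw [add_mul, mul_comm r]; omega)
      rw [this.1, this.2]
      exact ⟨_, by omega, Or.inl (Or.inr (Or.inl ⟨rfl, hc, rfl, rfl⟩))⟩
    · have := divmod_eq (k := k) (r := r) (c := c + 1) (x := x + 1) (by omega)
        (by rw [mul_comm r]; omega)
      rw [this.1, this.2]
      exact ⟨_, by omega, Or.inl (Or.inl ⟨rfl, rfl, rfl⟩)⟩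

lemma step_k {n q k x : ℕ} (hk : 2 ≤ k) (hq : 2 ≤ q) (hn : n + 1 = q * k) (hx : x < n) :
    ∃ i, i < 5 ∧
      (gridEdge q k (x / k) (x % k) ((x + k) % n / k) ((x + k) % n % k) i ∨
       gridEdge q k ((x + k) % n / k) ((x + k) % n % k) (x / k) (x % k) i) := by
  have h1 := Nat.div_add_mod x k
  have h2 := Nat.mod_lt x (show 0 < k by omega)
  have hkn : k < n := by nlinarith
  set r := x / k with hr
  set c := x % k with hc
  by_cases hxn : x + k < n
  · rw [Nat.mod_eq_of_lt hxn]
    have := divmod_eq (k := k) (r := r + 1) (c := c) (x := x + k) (by omega)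
      (by rw [add_mul, mul_comm r]; omega)
    rw [this.1, this.2]
    exact ⟨r % 2, by omega, Or.inl (Or.inr (Or.inr (Or.inl ⟨rfl, rfl, rfl⟩)))⟩
  · have hm : (x + k) % n = x + k - n := by
      rw [Nat.mod_eq_sub_mod (by omega), Nat.mod_eq_of_lt (by omega)]
    rw [hm]
    obtain ⟨q', rfl⟩ : ∃ q', q = q' + 2 := ⟨q - 2, by omega⟩
    rw [add_mul] at hn
    by_cases hx0 : x + k = n
    · have := divmod_eq (k := k) (r := q') (c := k - 1) (x := x) (by omega) (by omega)
      rw [hx0, Nat.sub_self, Nat.zero_div, Nat.zero_mod]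
      refine ⟨4, by omega, Or.inr (Or.inr ?_)⟩
      unfold tallEdge
      omega
    · have e1 := divmod_eq (k := k) (r := q' + 1) (c := x - (q' + 1) * k) (x := x)
        (by rw [add_mul]; omega) (by rw [add_mul]; omega)
      rw [add_mul] at e1
      have e2 := divmod_eq (k := k) (r := 0) (c := x + k - n) (x := x + k - n)
        (by omega) (by omega)
      refine ⟨1, by omega, Or.inr (Or.inr ?_)⟩
      unfold tallEdge
      omega

lemma hasMBE_even {n q k : ℕ} (hq : q % 2 = 0) (hq2 : 2 ≤ q) (hk : 2 ≤ k) (hqk : 5 ≤ q + k)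
    (hn : n + 1 = q * k) : HasMBE (circ n k) 5 := by
  have hn0 : 2 < n := by nlinarith
  haveI : NeZero n := ⟨by omega⟩
  have hok : ∀ v : ZMod n, okPt q k (v.val / k) (v.val % k) := fun v =>
    okPt_of_lt hk hn (ZMod.val_lt v)
  have hinj : ∀ u v : ZMod n, u.val / k = v.val / k → u.val % k = v.val % k → u = v := by
    intro u v h h'
    apply ZMod.val_injective n
    rw [← Nat.div_add_mod u.val k, h, h', Nat.div_add_mod]
  refine hasMBE_of_edges (fun v : ZMod n => bKey (v.val / k) (v.val % k)) ?_ _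
    (fun u v i => gridEdge q k (u.val / k) (u.val % k) (v.val / k) (v.val % k) i.val) ?_ ?_ ?_
  · intro u v h
    simp only at h
    have h1 : ¬ bLt (u.val / k) (u.val % k) (v.val / k) (v.val % k) := fun hl =>
      absurd (bKey_lt.mpr hl) (by rw [h]; exact lt_irrefl _)
    have h2 : ¬ bLt (v.val / k) (v.val % k) (u.val / k) (u.val % k) := fun hl =>
      absurd (bKey_lt.mpr hl) (by rw [h]; exact lt_irrefl _)
    unfold bLt at h1 h2
    apply hinj <;> omega
  · have A1 : ∀ u : ZMod n, (u + 1).val = (u.val + 1) % n := by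
      intro u
      rw [ZMod.val_add, ZMod.val_one'' (by omega)]
    have A2 : ∀ u : ZMod n, (u + (k : ZMod n)).val = (u.val + k) % n := by
      intro u
      rw [ZMod.val_add, ZMod.val_natCast, Nat.add_mod_mod]
    intro u v h
    rcases circ_adj h with h | h | h | h
    · obtain ⟨i, hi, h'⟩ := step_one hk hq2 hn (ZMod.val_lt u)
      rw [← A1 u, ← h] at h'
      exact ⟨⟨i, hi⟩, h'⟩
    · obtain ⟨i, hi, h'⟩ := step_k hk hq2 hn (ZMod.val_lt u)
      rw [← A2 u, ← h] at h'
      exact ⟨⟨i, hi⟩, h'⟩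
    · obtain ⟨i, hi, h'⟩ := step_one hk hq2 hn (ZMod.val_lt v)
      rw [← A1 v, ← h] at h'
      exact ⟨⟨i, hi⟩, h'.symm⟩
    · obtain ⟨i, hi, h'⟩ := step_k hk hq2 hn (ZMod.val_lt v)
      rw [← A2 v, ← h] at h'
      exact ⟨⟨i, hi⟩, h'.symm⟩
  · intro a b c d i e e'
    rcases grid_disjoint hq hq2 hk hqk (hok a) (hok b) (hok c) (hok d) e e' with h | h
    · exact Or.inl ⟨hinj _ _ h.1 h.2.1, hinj _ _ h.2.2.1 h.2.2.2⟩
    · refine Or.inr ⟨?_, ?_, ?_, ?_⟩ <;> rintro rfl <;> simp at h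
  · intro a b c d i e e' lo hi lo' hi' p p' l1 l2 l3
    simp only [bKey_lt] at l1 l2 l3
    have as : ∀ {r c r' c' : ℕ}, bLt r c r' c' → bLt r' c' r c → False := by
      intro r c r' c' h h'
      unfold bLt at h h'; omega
    have tr : ∀ {r c r' c' r'' c'' : ℕ}, bLt r c r' c' → bLt r' c' r'' c'' →
        bLt r c r'' c'' := by
      intro r c r' c' r'' c'' h h'
      unfold bLt at *; omega
    rcases e with ⟨e1, e2, -⟩ | e
    · rcases p with ⟨rfl, rfl⟩ | ⟨rfl, rfl⟩
      · rw [e2, ← e1] at l2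
        exact row_no_between ⟨l1, l2⟩
      · rw [e2, ← e1] at l1
        exact row_no_between' ⟨l1, l2⟩
    rcases e' with ⟨e1, e2, -⟩ | e'
    · rcases p' with ⟨rfl, rfl⟩ | ⟨rfl, rfl⟩
      · rw [e2, ← e1] at l3
        exact row_no_between ⟨l2, l3⟩
      · rw [e2, ← e1] at l2
        exact row_no_between' ⟨l2, l3⟩
    rcases p with ⟨rfl, rfl⟩ | ⟨rfl, rfl⟩
    · rcases p' with ⟨rfl, rfl⟩ | ⟨rfl, rfl⟩
      · exact tall_noncross hq hq2 hk hqk (hok _) (hok _) (hok _) (hok _) e e' l1 l2 l3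
      · exact as (tall_lt hk e' hq hq2) (tr l2 l3)
    · exact as (tall_lt hk e hq hq2) (tr l1 l2)

lemma HasMBE.of_iso {V W : Type*} {G : SimpleGraph V} {H : SimpleGraph W} (φ : V ≃ W)
    (hφ : ∀ u v, G.Adj u v → H.Adj (φ u) (φ v)) {m : ℕ} (h : HasMBE H m) : HasMBE G m := by
  obtain ⟨σ, col, h1, h2, h3⟩ := h
  have hc : Nat.card W = Nat.card V := (Nat.card_congr φ).symm
  refine ⟨(φ.trans σ).trans (finCongr hc), fun u v => col (φ u) (φ v), ?_, ?_, ?_⟩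
  · intro u v h
    exact h1 _ _ (hφ _ _ h)
  · intro u v w h h' hne
    exact h2 _ _ _ (hφ _ _ h) (hφ _ _ h') (fun e => hne (φ.injective e))
  · intro a b c d h h' hcr
    refine h3 _ _ _ _ (hφ _ _ h) (hφ _ _ h') ?_
    unfold ChordCross ChordBetween at *
    simp only [min_lt_iff, lt_max_iff, Fin.lt_def] at hcr ⊢
    exact hcr

lemma hasMBE_circ {n q k : ℕ} (hodd : Odd n) (hq3 : 3 ≤ q) (hk : 2 ≤ k)
    (hn : n + 1 = q * k) : HasMBE (circ n k) 5 := by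
  rcases Nat.even_or_odd q with hq | hq
  · exact hasMBE_even (Nat.even_iff.mp hq) (by omega) hk (by omega) hn
  · have hk2 : k % 2 = 0 := by
      have : Even (q * k) := by rw [← hn]; exact hodd.add_one
      rcases Nat.even_mul.mp this with h | h
      · exact absurd h (Nat.not_even_iff_odd.mpr hq)
      · exact Nat.even_iff.mp h
    have H : HasMBE (circ n q) 5 :=
      hasMBE_even hk2 hk (by omega) (by omega) (by rw [hn, mul_comm])
    have hone : (q : ZMod n) * (k : ZMod n) = 1 := by
      have : ((n + 1 : ℕ) : ZMod n) = ((q * k : ℕ) : ZMod n) := by rw [hn]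
      push_cast at this
      rw [← this]; simp
    let φ : ZMod n ≃ ZMod n :=
      { toFun := fun x => q * x
        invFun := fun x => k * x
        left_inv := fun x => by
          show (k : ZMod n) * (q * x) = x
          rw [← mul_assoc, mul_comm (k : ZMod n), hone, one_mul]
        right_inv := fun x => by
          show (q : ZMod n) * (k * x) = x
          rw [← mul_assoc, hone, one_mul] }
    refine HasMBE.of_iso φ ?_ H
    intro u v h
    have h' := circ_adj_iff.mp h
    refine circ_adj_iff.mpr ⟨fun e => h'.1 (φ.injective e), ?_⟩
    show (q : ZMod n) * v = q * u + 1 ∨ (q : ZMod n) * v = q * u + q ∨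
      (q : ZMod n) * u = q * v + 1 ∨ (q : ZMod n) * u = q * v + q
    rcases h'.2 with h | h | h | h
    · right; left; rw [h]; ring
    · left; rw [h, mul_add, hone]
    · right; right; right; rw [h]; ring
    · right; right; left; rw [h, mul_add, hone]

/-! ### Degrees and the lower bound -/

lemma circ_nbr {n k : ℕ} (hodd : Odd n) (hk : 2 ≤ k) (hk' : k ≤ n / 2) (v : ZMod n) :
    ((circ n k).neighborSet v).ncard = 4 := by
  obtain ⟨t, ht⟩ := hodd
  have cast0 : ∀ x : ℕ, 0 < x → x < n → (x : ZMod n) ≠ 0 := by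
    intro x h0 hx h
    rw [ZMod.natCast_eq_zero_iff] at h
    exact absurd (Nat.le_of_dvd h0 h) (by omega)
  have a1 := cast0 1 (by omega) (by omega)
  have a2 := cast0 2 (by omega) (by omega)
  have a3 := cast0 k (by omega) (by omega)
  have a4 := cast0 (k + k) (by omega) (by omega)
  have a5 := cast0 (k + 1) (by omega) (by omega)
  have a6 := cast0 (k - 1) (by omega) (by omega)
  rw [Nat.cast_sub (by omega)] at a6
  push_cast at a1 a2 a4 a5 a6
  have hs : (circ n k).neighborSet v = (({v + 1, v - 1, v + k, v - k} : Finset (ZMod n)) :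
      Set (ZMod n)) := by
    ext w
    simp only [SimpleGraph.mem_neighborSet, circ_adj_iff, Finset.coe_insert,
      Finset.coe_singleton, Set.mem_insert_iff, Set.mem_singleton_iff]
    constructor
    · rintro ⟨_, h | h | h | h⟩
      · exact Or.inl h
      · exact Or.inr (Or.inr (Or.inl h))
      · right; left; rw [h]; ring
      · right; right; right; rw [h]; ring
    · rintro (h | h | h | h)
      · exact ⟨fun e => a1 (by linear_combination -e - h), by simp [h]⟩
      · exact ⟨fun e => a1 (by linear_combination h + e), by simp [h]⟩
      · exact ⟨fun e => a3 (by linear_combination -e - h), by simp [h]⟩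
      · exact ⟨fun e => a3 (by linear_combination h + e), by simp [h]⟩
  rw [hs, Set.ncard_coe_finset]
  rw [Finset.card_insert_of_notMem, Finset.card_insert_of_notMem, Finset.card_pair]
  · intro e; exact a4 (by linear_combination e)
  · simp only [Finset.mem_insert, Finset.mem_singleton, not_or]
    exact ⟨fun e => a5 (by linear_combination -e), fun e => a6 (by linear_combination e)⟩
  · simp only [Finset.mem_insert, Finset.mem_singleton, not_or]
    exact ⟨fun e => a2 (by linear_combination e), fun e => a6 (by linear_combination -e),
      fun e => a5 (by linear_combination e)⟩

lemma HasMBE.mono {V : Type*} {G : SimpleGraph V} {m m' : ℕ} (hm : m ≤ m') (h : HasMBE G m) :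
    HasMBE G m' := by
  obtain ⟨σ, col, h1, h2, h3⟩ := h
  refine ⟨σ, fun u v => Fin.castLE hm (col u v), ?_, ?_, ?_⟩
  · intro u v h
    simp only [h1 u v h]
  · intro u v w h h' hne e
    exact h2 u v w h h' hne (Fin.castLE_injective hm e)
  · intro a b c d h h' hc e
    exact h3 a b c d h h' hc (Fin.castLE_injective hm e)

lemma not_hasMBE_four {V : Type*} [Fintype V] {G : SimpleGraph V}
    (hodd : Odd (Fintype.card V)) (hdeg : ∀ v, (G.neighborSet v).ncard = 4) :
    ¬ HasMBE G 4 := by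
  classical
  rintro ⟨σ, col, h1, h2, -⟩
  have ex : ∀ u, ∃ w, G.Adj u w ∧ col u w = 0 := by
    intro u
    have himg : (col u '' G.neighborSet u).ncard = 4 := by
      rw [Set.ncard_image_of_injOn, hdeg u]
      intro x hx y hy e
      by_contra hne
      exact h2 u x y hx hy hne e
    have : col u '' G.neighborSet u = Set.univ := by
      apply Set.eq_of_subset_of_ncard_le (Set.subset_univ _)
      rw [himg, Set.ncard_univ, Nat.card_eq_fintype_card, Fintype.card_fin]
    obtain ⟨w, hw, hw'⟩ : (0 : Fin 4) ∈ col u '' G.neighborSet u := by rw [this]; trivial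
    exact ⟨w, hw, hw'⟩
  choose w hw hw0 using ex
  have inv : Function.Involutive w := by
    intro u
    by_contra hne
    refine h2 (w u) (w (w u)) u (hw _) (hw u).symm hne ?_
    rw [hw0, ← h1 u (w u) (hw u), hw0]
  haveI : Fact (Nat.Prime 2) := ⟨Nat.prime_two⟩
  obtain ⟨a, ha⟩ := Equiv.Perm.exists_fixed_point_of_prime (p := 2) (n := 1)
    (by rw [Nat.two_dvd_ne_zero]; exact Nat.odd_iff.mp hodd)
    (σ := inv.toPerm) (by
      ext u
      simp [pow_two, inv u])
  exact (hw a).ne ha.symm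

/-- for `n` odd with `n ≡ k - 1 (mod k)`, `mbt(C(n,k)) = Δ(C(n,k)) + 1 = 5`. -/
theorem stmt16 (n k : ℕ) (hodd : Odd n) (hk : 2 ≤ k) (hk' : k ≤ n / 2)
    (hr : n % k = k - 1) :
    mbt (circ n k) = maxDeg (circ n k) + 1 ∧ maxDeg (circ n k) + 1 = 5 := by
  haveI : NeZero n := ⟨by omega⟩
  have hdeg := circ_nbr hodd hk hk'
  have hmax : maxDeg (circ n k) = 4 := by
    unfold maxDeg
    have : (fun v => ((circ n k).neighborSet v).ncard) = fun _ => 4 := funext hdeg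
    rw [this, Set.range_const, csSup_singleton]
  have hdm := Nat.div_add_mod n k
  have ha : 2 ≤ n / k := (Nat.le_div_iff_mul_le (by omega)).mpr (by omega)
  have hn : n + 1 = (n / k + 1) * k := by
    rw [add_mul, mul_comm (n / k)]; omega
  have h5 : HasMBE (circ n k) 5 := hasMBE_circ hodd (by omega) hk hn
  have h4 : ¬ HasMBE (circ n k) 4 := not_hasMBE_four (by rw [ZMod.card]; exact hodd) hdeg
  have hm : mbt (circ n k) = 5 := by
    unfold mbt
    apply le_antisymm (Nat.sInf_le h5)
    apply le_csInf ⟨5, h5⟩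
    intro m hm
    by_contra hlt
    exact h4 (HasMBE.mono (by omega) hm)
  rw [hm, hmax]
  exact ⟨rfl, rfl⟩
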